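/- Let I, I' ⊆ Π be μ-connected and let w ∈ W have minimal length in its double coset W_{I_*} w W_{I'_*}. Let red(w) = {α_{i₁}, …, α_{i_k}} for a reduced expression w = r_{i₁}⋯r_{i_k} (with red(1) = ∅; this set is independent of the chosen reduced expression). Then I ∪ I' ∪ red(w) is μ-connected, and the smallest face of H containing F_I ∪ wF_{I'} equals F_{I ∪ I' ∪ red(w)}. -/

import Mathlib

open Set Module

noncomputable section

/-- The linear reflection `x ↦ x - f x • a` associated to a vector `a` and a linear
functional `f` with `f a = 2`, bundled as a linear automorphism. -/
def reflEquiv {V : Type*} [AddCommGroup V] [Module ℝ V]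
    (a : V) (f : V →ₗ[ℝ] ℝ) (h2 : f a = 2) : V ≃ₗ[ℝ] V :=
  LinearEquiv.ofInvolutive (LinearMap.id - f.smulRight a)
    (fun x => by
      simp only [LinearMap.sub_apply, LinearMap.id_apply, LinearMap.smulRight_apply,
        map_sub, map_smul, smul_eq_mul, h2]
      module)

/-- A realization over `ℝ` of an `m × m` generalized Cartan matrix `A`:
simple roots `α_i`, simple coroots `α_i∨` (as linear functionals), with
`⟨α_j, α_i∨⟩ = a_{ij}`, together with the defining axioms. -/
structure GCMRealization (m : ℕ) (V : Type*) [NormedAddCommGroup V] [NormedSpace ℝ V] where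
  A : Matrix (Fin m) (Fin m) ℤ
  root : Fin m → V
  coroot : Fin m → V →ₗ[ℝ] ℝ
  one_le_m : 1 ≤ m
  A_diag : ∀ i, A i i = 2
  A_offdiag : ∀ i j, i ≠ j → A i j ≤ 0
  A_zero_iff : ∀ i j, A i j = 0 ↔ A j i = 0
  root_indep : LinearIndependent ℝ root
  coroot_indep : LinearIndependent ℝ coroot
  pairing : ∀ i j, coroot i (root j) = (A i j : ℝ)
  finDim : FiniteDimensional ℝ V
  dim_eq : finrank ℝ V + (A.map ((↑) : ℤ → ℝ)).rank = 2 * m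

/-- A face of a convex set `H`: a convex subset `F ⊆ H` such that whenever the open
segment between two points of `H` meets `F`, both points lie in `F`. -/
def IsFaceOf {V : Type*} [NormedAddCommGroup V] [NormedSpace ℝ V] (H F : Set V) : Prop :=
  Convex ℝ F ∧ IsExtreme ℝ H F

namespace GCMRealization

variable {m : ℕ} {V : Type*} [NormedAddCommGroup V] [NormedSpace ℝ V]
variable (S : GCMRealization m V)

/-- The fundamental reflection `r_i`. -/
def s (i : Fin m) : V ≃ₗ[ℝ] V :=
  reflEquiv (S.root i) (S.coroot i) (by
    have h := S.pairing i i
    rw [S.A_diag i] at h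
    simpa using h)

/-- The Weyl group `W`, as a subgroup of the group of linear automorphisms of `V`. -/
def W : Subgroup (V ≃ₗ[ℝ] V) := Subgroup.closure (Set.range S.s)

/-- The standard parabolic subgroup `W_I` generated by the reflections indexed by `I`. -/
def WI (I : Set (Fin m)) : Subgroup (V ≃ₗ[ℝ] V) := Subgroup.closure (S.s '' I)

/-- The closed fundamental chamber `C̄`. -/
def chamber : Set V := {η | ∀ i, 0 ≤ S.coroot i η}

/-- `J₀`: the set of indices `i` with `⟨μ, α_i∨⟩ = 0`. -/
def J0 (μ : V) : Set (Fin m) := {i | S.coroot i μ = 0}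

/-- The orbit of `μ` under a subgroup of linear automorphisms. -/
def orbitOf (G : Subgroup (V ≃ₗ[ℝ] V)) (μ : V) : Set V :=
  (fun w : V ≃ₗ[ℝ] V => w μ) '' (G : Set (V ≃ₗ[ℝ] V))

/-- `F_I`: the convex hull of `W_I · μ`. -/
def face (μ : V) (I : Set (Fin m)) : Set V := convexHull ℝ (orbitOf (S.WI I) μ)

/-- `H`: the convex hull of the Weyl group orbit of `μ`. -/
def orbitHull (μ : V) : Set V := convexHull ℝ (orbitOf S.W μ)

/-- `ℝ₊I`: the set of nonnegative linear combinations of the simple roots indexed by `I`. -/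
def coneNonneg (I : Set (Fin m)) : Set V :=
  {v | ∃ c : Fin m → ℝ, (∀ i, 0 ≤ c i) ∧ (∀ i, i ∉ I → c i = 0) ∧ v = ∑ i, c i • S.root i}

/-- `ℝ_>I`: the set of strictly positive linear combinations of the simple roots indexed
by `I` (with `ℝ_>∅ = {0}`). -/
def conePos (I : Set (Fin m)) : Set V :=
  {v | ∃ c : Fin m → ℝ, (∀ i ∈ I, 0 < c i) ∧ (∀ i, i ∉ I → c i = 0) ∧ v = ∑ i, c i • S.root i}

/-- The open standard facet `C_J`. -/
def openFacet (J : Set (Fin m)) : Set V :=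
  {η | (∀ i ∈ J, S.coroot i η = 0) ∧ ∀ i, i ∉ J → 0 < S.coroot i η}

/-- The closed standard facet `C̄_J`. -/
def closedFacet (J : Set (Fin m)) : Set V :=
  {η | (∀ i ∈ J, S.coroot i η = 0) ∧ ∀ i, i ∉ J → 0 ≤ S.coroot i η}

/-- Adjacency of two vertices of the Dynkin diagram: `i ≠ j` and `a_{ij} ≠ 0`
(equivalently `a_{ji} ≠ 0`). -/
def Adjacent (i j : Fin m) : Prop := i ≠ j ∧ S.A i j ≠ 0 ∧ S.A j i ≠ 0

/-- The Dynkin diagram, as a simple graph on the index set. -/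
def diagram : SimpleGraph (Fin m) where
  Adj := S.Adjacent
  symm := ⟨fun _ _ h => ⟨h.1.symm, h.2.2, h.2.1⟩⟩
  loopless := ⟨fun _ h => h.1 rfl⟩

/-- A subset `I` is `μ`-connected if every connected component of `I` meets
`J_> = Π \ J₀` (the empty set is `μ`-connected). -/
def MuConnected (μ : V) (I : Set (Fin m)) : Prop :=
  ∀ i : I, ∃ j : I, S.coroot (j : Fin m) μ ≠ 0 ∧ (S.diagram.induce I).Reachable i j

/-- The connected component of `i` inside `K`, as a subset of the index set. -/
def comp (K : Set (Fin m)) (i : Fin m) : Set (Fin m) :=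
  {j | ∃ (hi : i ∈ K) (hj : j ∈ K), (S.diagram.induce K).Reachable ⟨i, hi⟩ ⟨j, hj⟩}

/-- `I*`: the largest `μ`-connected subset of `I`, i.e. the union of the connected
components of `I` that meet `J_>`. -/
def muPart (μ : V) (I : Set (Fin m)) : Set (Fin m) :=
  {j | ∃ (hj : j ∈ I) (k : Fin m) (hk : k ∈ I), S.coroot k μ ≠ 0 ∧
    (S.diagram.induce I).Reachable ⟨j, hj⟩ ⟨k, hk⟩}

/-- `I_*`: the set of `α ∈ J₀ \ I` orthogonal to all of `I`. -/
def starSet (μ : V) (I : Set (Fin m)) : Set (Fin m) :=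
  {i | S.coroot i μ = 0 ∧ i ∉ I ∧ ∀ j ∈ I, S.coroot i (S.root j) = 0}

/-- A subset `K ⊆ Π` is of finite type if the subgroup `W_K` is finite. -/
def FiniteType (K : Set (Fin m)) : Prop := ((S.WI K : Subgroup (V ≃ₗ[ℝ] V)) : Set (V ≃ₗ[ℝ] V)).Finite

/-- Every connected component of `K` is of finite type. -/
def FinTypeComponents (K : Set (Fin m)) : Prop := ∀ i ∈ K, S.FiniteType (S.comp K i)

/-- A fundamental face of `H`: a face which is empty or whose relative interior meets
the fundamental chamber. -/
def IsFundFace (μ : V) (F : Set V) : Prop :=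
  IsFaceOf (S.orbitHull μ) F ∧ (F = ∅ ∨ (intrinsicInterior ℝ F ∩ S.chamber).Nonempty)

/-- The length of `w ∈ W` with respect to the fundamental reflections. -/
def len (w : V ≃ₗ[ℝ] V) : ℕ :=
  sInf {k | ∃ l : List (Fin m), l.length = k ∧ w = (l.map S.s).prod}

end GCMRealization

end

namespace GCMRealization

variable {m : ℕ} {V : Type*} [NormedAddCommGroup V] [NormedSpace ℝ V]
variable (S : GCMRealization m V)

lemma s_apply (i : Fin m) (x : V) : S.s i x = x - S.coroot i x • S.root i := by
  simp [s, reflEquiv, LinearEquiv.ofInvolutive]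

lemma coroot_self (i : Fin m) : S.coroot i (S.root i) = 2 := by
  rw [S.pairing, S.A_diag]; norm_num

lemma coroot_offdiag {i j : Fin m} (h : i ≠ j) : S.coroot i (S.root j) ≤ 0 := by
  rw [S.pairing]; exact_mod_cast S.A_offdiag i j h

lemma coroot_s_self (i : Fin m) (x : V) : S.coroot i (S.s i x) = - S.coroot i x := by
  rw [s_apply, map_sub, map_smul, coroot_self, smul_eq_mul]; ring

lemma coroot_s (i j : Fin m) (x : V) :
    S.coroot i (S.s j x) = S.coroot i x - S.coroot i (S.root j) * S.coroot j x := by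
  rw [s_apply, map_sub, map_smul, smul_eq_mul]; ring

lemma s_s (i : Fin m) (x : V) : S.s i (S.s i x) = x := by
  rw [s_apply, coroot_s_self, s_apply]; module

lemma s_mul_s (i : Fin m) : S.s i * S.s i = 1 := by
  ext x; simp [LinearEquiv.mul_apply, s_s]

lemma s_inv (i : Fin m) : (S.s i)⁻¹ = S.s i :=
  inv_eq_of_mul_eq_one_left (S.s_mul_s i)

lemma s_mul_s_mul (i : Fin m) (w : V ≃ₗ[ℝ] V) : S.s i * (S.s i * w) = w := by
  rw [← mul_assoc, s_mul_s, one_mul]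

lemma s_mem (i : Fin m) : S.s i ∈ S.W := Subgroup.subset_closure ⟨i, rfl⟩

lemma s_mem_WI {I : Set (Fin m)} {i : Fin m} (h : i ∈ I) : S.s i ∈ S.WI I :=
  Subgroup.subset_closure ⟨i, h, rfl⟩

lemma WI_mono {I J : Set (Fin m)} (h : I ⊆ J) : S.WI I ≤ S.WI J :=
  Subgroup.closure_mono (Set.image_mono h)

lemma WI_le (I : Set (Fin m)) : S.WI I ≤ S.W :=
  Subgroup.closure_mono (Set.image_subset_range _ _)

lemma prod_mem (l : List (Fin m)) : (l.map S.s).prod ∈ S.W := by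
  apply Subgroup.list_prod_mem
  intro x hx
  obtain ⟨i, -, rfl⟩ := List.mem_map.1 hx
  exact S.s_mem i

lemma prod_inv (l : List (Fin m)) : (l.map S.s).prod⁻¹ = (l.reverse.map S.s).prod := by
  induction l with
  | nil => simp
  | cons a l ih => simp [ih, s_inv]

/-- Induction along words in a parabolic subgroup. -/
lemma WI_induction {I : Set (Fin m)} {p : (V ≃ₗ[ℝ] V) → Prop} (h1 : p 1)
    (hs : ∀ i ∈ I, ∀ u ∈ S.WI I, p u → p (S.s i * u)) {u : V ≃ₗ[ℝ] V} (hu : u ∈ S.WI I) :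
    p u := by
  refine Subgroup.closure_induction_left (p := fun u _ => p u) h1 ?_ ?_ hu
  · rintro _ ⟨i, hi, rfl⟩ y hy h
    exact hs i hi y hy h
  · rintro _ ⟨i, hi, rfl⟩ y hy h
    rw [s_inv]; exact hs i hi y hy h

lemma W_eq : S.W = S.WI Set.univ := by simp [W, WI]

lemma exists_word {w : V ≃ₗ[ℝ] V} (hw : w ∈ S.W) : ∃ l : List (Fin m), w = (l.map S.s).prod := by
  rw [W_eq] at hw
  refine S.WI_induction (p := fun w => ∃ l : List (Fin m), w = (l.map S.s).prod) ⟨[], by simp⟩ ?_ hw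
  rintro i - u - ⟨l, rfl⟩
  exact ⟨i :: l, by simp⟩

lemma len_prod_le (l : List (Fin m)) : S.len (l.map S.s).prod ≤ l.length :=
  Nat.sInf_le ⟨l, rfl, rfl⟩

lemma exists_red {w : V ≃ₗ[ℝ] V} (hw : w ∈ S.W) :
    ∃ l : List (Fin m), l.length = S.len w ∧ w = (l.map S.s).prod := by
  obtain ⟨l, hl⟩ := S.exists_word hw
  exact Nat.sInf_mem (s := {k | ∃ l : List (Fin m), l.length = k ∧ w = (l.map S.s).prod})
    ⟨_, l, rfl, hl⟩

lemma len_s_mul_le (i : Fin m) {w : V ≃ₗ[ℝ] V} (hw : w ∈ S.W) :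
    S.len (S.s i * w) ≤ S.len w + 1 := by
  obtain ⟨l, h1, h2⟩ := S.exists_red hw
  have := S.len_prod_le (i :: l)
  rw [List.map_cons, List.prod_cons, ← h2] at this
  simpa [h1] using this

lemma len_inv_le {w : V ≃ₗ[ℝ] V} (hw : w ∈ S.W) : S.len w⁻¹ ≤ S.len w := by
  obtain ⟨l, h1, h2⟩ := S.exists_red hw
  have := S.len_prod_le l.reverse
  rw [← prod_inv, ← h2] at this
  simpa [h1] using this

lemma len_inv {w : V ≃ₗ[ℝ] V} (hw : w ∈ S.W) : S.len w⁻¹ = S.len w := by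
  apply le_antisymm (S.len_inv_le hw)
  simpa using S.len_inv_le (S.W.inv_mem hw)

/-! ### Alternating words and rank two computations -/

/-- The alternating product `s_a s_b s_a ⋯` with `n` factors. -/
def altW (S : GCMRealization m V) : Fin m → Fin m → ℕ → (V ≃ₗ[ℝ] V)
  | _, _, 0 => 1
  | a, b, n + 1 => S.s a * altW S b a n

lemma altW_mem (a b : Fin m) (n : ℕ) : S.altW a b n ∈ S.W := by
  induction n generalizing a b with
  | zero => exact S.W.one_mem
  | succ n ih => exact S.W.mul_mem (S.s_mem a) (ih b a)

lemma len_altW_mul_le (a b : Fin m) (n : ℕ) {v : V ≃ₗ[ℝ] V} (hv : v ∈ S.W) :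
    S.len (S.altW a b n * v) ≤ n + S.len v := by
  induction n generalizing a b with
  | zero => simp [altW]
  | succ n ih =>
    rw [altW, mul_assoc]
    have h1 := S.len_s_mul_le a (S.W.mul_mem (S.altW_mem b a n) hv)
    have h2 := ih b a
    omega

lemma altW_succ_right (a b : Fin m) (n : ℕ) :
    S.altW a b (n + 1) = S.altW a b n * S.s (if Even n then a else b) := by
  induction n generalizing a b with
  | zero => simp [altW]
  | succ n ih =>
    rw [altW, ih b a, altW, mul_assoc]
    by_cases h : Even n <;> simp [h, Nat.even_add_one]

/-- `α_i∨ ∘ w` restricted to the alternating word is a nonnegative combination of the two coroots. -/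
def Good2 (i j : Fin m) (n : ℕ) : Prop :=
  ∃ a b : ℝ, 0 ≤ a ∧ 0 ≤ b ∧
    ∀ x, S.coroot i (S.altW j i n x) = a * S.coroot i x + b * S.coroot j x

lemma good2_large_aux (n : ℕ) : ∀ (i j : Fin m) (_ : i ≠ j)
    (_ : 4 ≤ S.coroot i (S.root j) * S.coroot j (S.root i)) (x y : ℝ) (_ : 0 ≤ x) (_ : 0 ≤ y)
    (_ : 2 * y ≤ - S.coroot i (S.root j) * x),
    ∃ a b : ℝ, 0 ≤ a ∧ 0 ≤ b ∧ ∀ v, x * S.coroot i (S.altW j i n v) +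
      y * S.coroot j (S.altW j i n v) = a * S.coroot i v + b * S.coroot j v := by
  induction n with
  | zero => intro i j _ _ x y hx hy _; exact ⟨x, y, hx, hy, fun v => by simp [altW]⟩
  | succ n ih =>
    intro i j hij h4 x y hx hy hxy
    have hp := S.coroot_offdiag hij
    have hq := S.coroot_offdiag hij.symm
    obtain ⟨a, b, ha, hb, h⟩ := ih j i hij.symm (by rw [mul_comm]; exact h4)
      (- S.coroot i (S.root j) * x - y) x (by nlinarith) hx (by
        nlinarith [mul_nonneg (neg_nonneg.2 hq) (sub_nonneg.2 hxy), mul_nonneg hx (sub_nonneg.2 h4)])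
    refine ⟨b, a, hb, ha, fun v => ?_⟩
    have := h v
    simp only [altW, LinearEquiv.mul_apply]
    rw [coroot_s_self, coroot_s]
    linarith

lemma good2_large {i j : Fin m} (hij : i ≠ j)
    (h4 : 4 ≤ S.coroot i (S.root j) * S.coroot j (S.root i)) (n : ℕ) : S.Good2 i j n := by
  obtain ⟨a, b, ha, hb, h⟩ := S.good2_large_aux n i j hij h4 1 0 zero_le_one le_rfl
    (by have := S.coroot_offdiag hij; linarith)
  exact ⟨a, b, ha, hb, fun x => by simpa using h x⟩

lemma small_cases {i j : Fin m} (hij : i ≠ j)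
    (h4 : S.coroot i (S.root j) * S.coroot j (S.root i) < 4) :
    (S.coroot i (S.root j), S.coroot j (S.root i)) ∈
      ({(0,0), (-1,-1), (-1,-2), (-2,-1), (-1,-3), (-3,-1)} : Set (ℝ × ℝ)) := by
  have hp := S.A_offdiag i j hij
  have hq := S.A_offdiag j i hij.symm
  have hz := S.A_zero_iff i j
  rw [S.pairing, S.pairing] at *
  have h4' : S.A i j * S.A j i < 4 := by exact_mod_cast h4
  generalize S.A i j = p at *
  generalize S.A j i = q at *
  have key : (p = 0 ∧ q = 0) ∨ (p = -1 ∧ q = -1) ∨ (p = -1 ∧ q = -2) ∨ (p = -2 ∧ q = -1) ∨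
      (p = -1 ∧ q = -3) ∨ (p = -3 ∧ q = -1) := by
    by_cases h0 : p = 0
    · simp [h0, hz.1 h0]
    have h0' : q ≠ 0 := fun h => h0 (hz.2 h)
    have p1 : p ≤ -1 := by omega
    have q1 : q ≤ -1 := by omega
    have : -3 ≤ p := by nlinarith
    have : -3 ≤ q := by nlinarith
    interval_cases p <;> interval_cases q <;> simp_all
  rcases key with ⟨rfl, rfl⟩ | ⟨rfl, rfl⟩ | ⟨rfl, rfl⟩ | ⟨rfl, rfl⟩ | ⟨rfl, rfl⟩ | ⟨rfl, rfl⟩ <;> simp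

lemma s_comb_left (i j : Fin m) (x : V) (a b : ℝ) :
    S.s i (x + a • S.root i + b • S.root j) =
      x + (-(S.coroot i x) - a - S.coroot i (S.root j) * b) • S.root i + b • S.root j := by
  rw [s_apply]; simp only [map_add, map_smul, coroot_self, smul_eq_mul]; module

lemma s_comb_right (i j : Fin m) (x : V) (a b : ℝ) :
    S.s j (x + a • S.root i + b • S.root j) =
      x + a • S.root i + (-(S.coroot j x) - b - S.coroot j (S.root i) * a) • S.root j := by
  rw [s_apply]; simp only [map_add, map_smul, coroot_self, smul_eq_mul]; module

lemma rank2 {i j : Fin m} (hij : i ≠ j) :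
    (∀ n, S.Good2 i j n) ∨ ∃ M, 1 ≤ M ∧ S.altW j i M = S.altW i j M ∧ ∀ n < M, S.Good2 i j n := by
  by_cases h4 : 4 ≤ S.coroot i (S.root j) * S.coroot j (S.root i)
  · exact Or.inl (S.good2_large hij h4)
  right
  have hc := S.small_cases hij (not_le.1 h4)
  simp only [Set.mem_insert_iff, Set.mem_singleton_iff, Prod.mk.injEq] at hc
  have key : ∀ M, (∀ x, S.altW j i M (x + (0:ℝ) • S.root i + (0:ℝ) • S.root j) =
      S.altW i j M (x + (0:ℝ) • S.root i + (0:ℝ) • S.root j)) → S.altW j i M = S.altW i j M := by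
    intro M h; ext x; simpa using h x
  rcases hc with ⟨h1, h2⟩ | ⟨h1, h2⟩ | ⟨h1, h2⟩ | ⟨h1, h2⟩ | ⟨h1, h2⟩ | ⟨h1, h2⟩
  · refine ⟨2, by norm_num, key _ fun x => ?_, fun n hn => ?_⟩
    · simp only [altW, LinearEquiv.mul_apply, LinearEquiv.coe_one, id, s_comb_left, s_comb_right, h1, h2]
      module
    · interval_cases n
      · exact ⟨1, 0, by norm_num, by norm_num, fun x => by simp [altW]⟩
      · exact ⟨1, 0, by norm_num, by norm_num, fun x => by simp [altW, coroot_s, h1]⟩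
  · refine ⟨3, by norm_num, key _ fun x => ?_, fun n hn => ?_⟩
    · simp only [altW, LinearEquiv.mul_apply, LinearEquiv.coe_one, id, s_comb_left, s_comb_right, h1, h2]
      module
    · interval_cases n
      · exact ⟨1, 0, by norm_num, by norm_num, fun x => by simp [altW]⟩
      · exact ⟨1, 1, by norm_num, by norm_num, fun x => by simp [altW, coroot_s, h1, h2, coroot_self]⟩
      · exact ⟨0, 1, by norm_num, by norm_num, fun x => by
          simp [altW, LinearEquiv.mul_apply, coroot_s, h1, h2, coroot_self]; ring⟩
  · refine ⟨4, by norm_num, key _ fun x => ?_, fun n hn => ?_⟩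
    · simp only [altW, LinearEquiv.mul_apply, LinearEquiv.coe_one, id, s_comb_left, s_comb_right, h1, h2]
      module
    · interval_cases n
      · exact ⟨1, 0, by norm_num, by norm_num, fun x => by simp [altW]⟩
      · exact ⟨1, 1, by norm_num, by norm_num, fun x => by
          simp [altW, LinearEquiv.mul_apply, coroot_s, h1, h2, coroot_self]⟩
      · exact ⟨1, 1, by norm_num, by norm_num, fun x => by
          simp [altW, LinearEquiv.mul_apply, coroot_s, h1, h2, coroot_self]; ring⟩
      · exact ⟨1, 0, by norm_num, by norm_num, fun x => by
          simp [altW, LinearEquiv.mul_apply, coroot_s, h1, h2, coroot_self]; ring⟩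
  · refine ⟨4, by norm_num, key _ fun x => ?_, fun n hn => ?_⟩
    · simp only [altW, LinearEquiv.mul_apply, LinearEquiv.coe_one, id, s_comb_left, s_comb_right, h1, h2]
      module
    · interval_cases n
      · exact ⟨1, 0, by norm_num, by norm_num, fun x => by simp [altW]⟩
      · exact ⟨1, 2, by norm_num, by norm_num, fun x => by
          simp [altW, LinearEquiv.mul_apply, coroot_s, h1, h2, coroot_self]⟩
      · exact ⟨1, 2, by norm_num, by norm_num, fun x => by
          simp [altW, LinearEquiv.mul_apply, coroot_s, h1, h2, coroot_self]; ring⟩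
      · exact ⟨1, 0, by norm_num, by norm_num, fun x => by
          simp [altW, LinearEquiv.mul_apply, coroot_s, h1, h2, coroot_self]; ring⟩
  · refine ⟨6, by norm_num, key _ fun x => ?_, fun n hn => ?_⟩
    · simp only [altW, LinearEquiv.mul_apply, LinearEquiv.coe_one, id, s_comb_left, s_comb_right, h1, h2]
      module
    · interval_cases n
      · exact ⟨1, 0, by norm_num, by norm_num, fun x => by simp [altW]⟩
      · exact ⟨1, 1, by norm_num, by norm_num, fun x => by
          simp [altW, LinearEquiv.mul_apply, coroot_s, h1, h2, coroot_self]⟩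
      · exact ⟨2, 1, by norm_num, by norm_num, fun x => by
          simp [altW, LinearEquiv.mul_apply, coroot_s, h1, h2, coroot_self]; ring⟩
      · exact ⟨2, 1, by norm_num, by norm_num, fun x => by
          simp [altW, LinearEquiv.mul_apply, coroot_s, h1, h2, coroot_self]; ring⟩
      · exact ⟨1, 1, by norm_num, by norm_num, fun x => by
          simp [altW, LinearEquiv.mul_apply, coroot_s, h1, h2, coroot_self]; ring⟩
      · exact ⟨1, 0, by norm_num, by norm_num, fun x => by
          simp [altW, LinearEquiv.mul_apply, coroot_s, h1, h2, coroot_self]; ring⟩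
  · refine ⟨6, by norm_num, key _ fun x => ?_, fun n hn => ?_⟩
    · simp only [altW, LinearEquiv.mul_apply, LinearEquiv.coe_one, id, s_comb_left, s_comb_right, h1, h2]
      module
    · interval_cases n
      · exact ⟨1, 0, by norm_num, by norm_num, fun x => by simp [altW]⟩
      · exact ⟨1, 3, by norm_num, by norm_num, fun x => by
          simp [altW, LinearEquiv.mul_apply, coroot_s, h1, h2, coroot_self]⟩
      · exact ⟨2, 3, by norm_num, by norm_num, fun x => by
          simp [altW, LinearEquiv.mul_apply, coroot_s, h1, h2, coroot_self]; ring⟩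
      · exact ⟨2, 3, by norm_num, by norm_num, fun x => by
          simp [altW, LinearEquiv.mul_apply, coroot_s, h1, h2, coroot_self]; ring⟩
      · exact ⟨1, 3, by norm_num, by norm_num, fun x => by
          simp [altW, LinearEquiv.mul_apply, coroot_s, h1, h2, coroot_self]; ring⟩
      · exact ⟨1, 0, by norm_num, by norm_num, fun x => by
          simp [altW, LinearEquiv.mul_apply, coroot_s, h1, h2, coroot_self]; ring⟩

/-- A function on `V` that is a nonnegative combination of the simple coroots. -/
def PosFun (f : V → ℝ) : Prop :=
  ∃ c : Fin m → ℝ, (∀ k, 0 ≤ c k) ∧ ∀ x, f x = ∑ k, c k * S.coroot k x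

lemma posFun_coroot (i : Fin m) : S.PosFun (fun x => S.coroot i x) := by
  classical
  refine ⟨fun k => if k = i then 1 else 0, fun k => by positivity, fun x => by simp⟩

lemma PosFun.comb {f g h : V → ℝ} (hf : S.PosFun f) (hg : S.PosFun g) {a b : ℝ} (ha : 0 ≤ a)
    (hb : 0 ≤ b) (hh : ∀ x, h x = a * f x + b * g x) : S.PosFun h := by
  obtain ⟨c, hc, hfc⟩ := hf
  obtain ⟨d, hd, hgd⟩ := hg
  refine ⟨fun k => a * c k + b * d k, fun k => ?_, fun x => ?_⟩
  · have := hc k; have := hd k; positivity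
  · rw [hh, hfc, hgd, Finset.mul_sum, Finset.mul_sum, ← Finset.sum_add_distrib]
    exact Finset.sum_congr rfl fun k _ => by ring

lemma eq_one_of_len {w : V ≃ₗ[ℝ] V} (hw : w ∈ S.W) (h : S.len w = 0) : w = 1 := by
  obtain ⟨l, h1, h2⟩ := S.exists_red hw
  rw [h, List.length_eq_zero_iff] at h1
  simpa [h1] using h2

lemma exists_left_descent {w : V ≃ₗ[ℝ] V} (hw : w ∈ S.W) (h : S.len w ≠ 0) :
    ∃ j, ∃ v ∈ S.W, w = S.s j * v ∧ S.len w = 1 + S.len v := by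
  obtain ⟨l, h1, h2⟩ := S.exists_red hw
  cases l with
  | nil => simp at h1; omega
  | cons j l =>
    refine ⟨j, (l.map S.s).prod, S.prod_mem l, by simpa using h2, ?_⟩
    have a := S.len_prod_le l
    have b := S.len_s_mul_le j (S.prod_mem l)
    simp only [List.map_cons, List.prod_cons] at h2
    rw [← h2] at b
    simp at h1
    omega

theorem posFun_of_len_aux (N : ℕ) : ∀ w ∈ S.W, S.len w = N → ∀ i, S.len w ≤ S.len (S.s i * w) →
    S.PosFun (fun x => S.coroot i (w x)) := by
  induction N using Nat.strong_induction_on with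
  | _ N ih =>
  intro w hw hN i hi
  by_cases h0 : S.len w = 0
  · rw [S.eq_one_of_len hw h0]; exact S.posFun_coroot i
  obtain ⟨j, v₁, hv₁, hwv₁, hlen₁⟩ := S.exists_left_descent hw h0
  have hij : i ≠ j := by
    rintro rfl
    rw [hwv₁, s_mul_s_mul, ← hwv₁] at hi
    omega
  let P : ℕ → Prop := fun n => ∃ v ∈ S.W, w = S.altW j i n * v ∧ S.len w = n + S.len v
  have hP1 : P 1 := ⟨v₁, hv₁, by simpa [altW] using hwv₁, hlen₁⟩
  have hPd : ∀ n, P (n + 1) → P n := by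
    rintro n ⟨v, hv, hwv, hl⟩
    have hsv := S.W.mul_mem (S.s_mem (if Even n then j else i)) hv
    refine ⟨_, hsv, by rw [hwv, altW_succ_right, mul_assoc], ?_⟩
    have a := S.len_s_mul_le (if Even n then j else i) hv
    have b := S.len_altW_mul_le j i n hsv
    rw [← mul_assoc, ← altW_succ_right, ← hwv] at b
    omega
  have hPle : ∀ n k, P (n + k) → P n := by
    intro n k
    induction k with
    | zero => exact id
    | succ k ihk => exact fun h => ihk (hPd _ h)
  obtain ⟨n, hPn, hPn'⟩ : ∃ n, P (n + 1) ∧ ¬ P (n + 2) := by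
    by_contra hcon
    push Not at hcon
    have : ∀ n, P (n + 1) := by
      intro n
      induction n with
      | zero => exact hP1
      | succ n ihn => exact hcon n ihn
    obtain ⟨v, -, -, h⟩ := this (S.len w)
    omega
  obtain ⟨v, hv, hwv, hl⟩ := id hPn
  -- both reflections do not shorten `v`
  have hx : S.len v ≤ S.len (S.s (if Even (n + 1) then j else i) * v) := by
    by_contra hlt
    apply hPn'
    have hsv := S.W.mul_mem (S.s_mem (if Even (n + 1) then j else i)) hv
    have e : w = S.altW j i (n + 2) * (S.s (if Even (n + 1) then j else i) * v) := by
      rw [altW_succ_right, mul_assoc, s_mul_s_mul, hwv]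
    refine ⟨_, hsv, e, ?_⟩
    have b := S.len_altW_mul_le j i (n + 2) hsv
    rw [← e] at b
    omega
  have hy : S.len v ≤ S.len (S.s (if Even n then j else i) * v) := by
    by_contra hlt
    have hsv := S.W.mul_mem (S.s_mem (if Even n then j else i)) hv
    have b := S.len_altW_mul_le j i n hsv
    rw [← mul_assoc, ← altW_succ_right, ← hwv] at b
    omega
  have hboth : S.len v ≤ S.len (S.s i * v) ∧ S.len v ≤ S.len (S.s j * v) := by
    by_cases he : Even n
    · simp only [he, if_true, Nat.even_add_one, not_true, if_false] at hx hy
      exact ⟨hx, hy⟩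
    · simp only [he, if_true, Nat.even_add_one, not_false_iff, if_false] at hx hy
      exact ⟨hy, hx⟩
  have pi := ih (S.len v) (by omega) v hv rfl i hboth.1
  have pj := ih (S.len v) (by omega) v hv rfl j hboth.2
  have hg : S.Good2 i j (n + 1) := by
    rcases S.rank2 hij with h | ⟨M, hM1, hbr, hM⟩
    · exact h _
    · by_cases hnM : n + 1 < M
      · exact hM _ hnM
      exfalso
      obtain ⟨k, hk⟩ := Nat.exists_eq_add_of_le (not_lt.1 hnM)
      rw [hk] at hPn
      obtain ⟨v', hv', hwv', hl'⟩ := hPle _ _ hPn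
      obtain ⟨M', rfl⟩ := Nat.exists_eq_add_of_le' hM1
      rw [hbr, altW, mul_assoc] at hwv'
      have b := S.len_altW_mul_le j i M' hv'
      rw [hwv', s_mul_s_mul, ← hwv'] at hi
      omega
  obtain ⟨a, b, ha, hb, hab⟩ := hg
  exact PosFun.comb S pi pj ha hb fun x => by rw [hwv, LinearEquiv.mul_apply]; exact hab _

theorem posFun_of_len {w : V ≃ₗ[ℝ] V} (hw : w ∈ S.W) {i : Fin m}
    (h : S.len w ≤ S.len (S.s i * w)) : S.PosFun (fun x => S.coroot i (w x)) :=
  S.posFun_of_len_aux _ w hw rfl i h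

/-! ### The orbit of a dominant vector -/

lemma PosFun.nonneg {f : V → ℝ} (hf : S.PosFun f) {μ : V} (hμ : μ ∈ S.chamber) : 0 ≤ f μ := by
  obtain ⟨c, hc, h⟩ := hf
  rw [h]
  exact Finset.sum_nonneg fun k _ => mul_nonneg (hc k) (hμ k)

theorem orbit_aux {μ : V} (hμ : μ ∈ S.chamber) (N : ℕ) : ∀ u ∈ S.W, S.len u = N →
    ∃ c : Fin m → ℝ, (∀ k, 0 ≤ c k) ∧ u μ = μ - ∑ k, c k • S.root k ∧
      ∃ v ∈ S.WI {k | c k ≠ 0}, u μ = v μ := by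
  classical
  induction N with
  | zero =>
    intro u hu h
    rw [S.eq_one_of_len hu h]
    exact ⟨0, fun _ => le_rfl, by simp, 1, Subgroup.one_mem _, rfl⟩
  | succ N ih =>
    intro u hu h
    obtain ⟨i, u', hu', rfl, hl⟩ := S.exists_left_descent hu (by omega)
    obtain ⟨c, hc, hcu, v, hv, hvu⟩ := ih u' hu' (by omega)
    have hpos := (S.posFun_of_len hu' (i := i) (by omega)).nonneg S hμ
    rw [LinearEquiv.mul_apply]
    rcases hpos.eq_or_lt with h0 | h0
    · have : S.s i (u' μ) = u' μ := by rw [s_apply]; simp [← h0]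
      rw [this]
      exact ⟨c, hc, hcu, v, hv, hvu⟩
    · refine ⟨fun k => c k + if k = i then S.coroot i (u' μ) else 0, fun k => ?_, ?_,
        S.s i * v, ?_, ?_⟩
      · have := hc k
        dsimp only
        split_ifs <;> linarith
      · simp only [add_smul, Finset.sum_add_distrib, ite_smul, zero_smul, Finset.sum_ite_eq',
          Finset.mem_univ, if_true]
        rw [s_apply]
        nth_rewrite 1 [hcu]
        abel
      · refine Subgroup.mul_mem _ (S.s_mem_WI ?_) (S.WI_mono ?_ hv)
        · have := hc i
          simp only [Set.mem_setOf_eq, if_true]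
          positivity
        · intro k hk
          have h1 := hc k
          have h2 : 0 < c k := lt_of_le_of_ne h1 (Ne.symm hk)
          simp only [Set.mem_setOf_eq]
          split_ifs <;> linarith
      · rw [LinearEquiv.mul_apply, hvu]

theorem orbit {μ : V} (hμ : μ ∈ S.chamber) {u : V ≃ₗ[ℝ] V} (hu : u ∈ S.W) :
    ∃ c : Fin m → ℝ, (∀ k, 0 ≤ c k) ∧ u μ = μ - ∑ k, c k • S.root k ∧
      ∃ v ∈ S.WI {k | c k ≠ 0}, u μ = v μ := S.orbit_aux hμ _ u hu rfl

lemma exists_dual (L : Set (Fin m)) : ∃ φ : V →ₗ[ℝ] ℝ, (∀ i ∈ L, φ (S.root i) = 0) ∧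
    ∀ i ∉ L, φ (S.root i) = 1 := by
  classical
  obtain ⟨φ, hφ⟩ := ((Basis.span S.root_indep).constr ℝ (fun i => if i ∈ L then (0:ℝ) else 1)).exists_extend
  have : ∀ i, φ (S.root i) = if i ∈ L then (0:ℝ) else 1 := by
    intro i
    have h := LinearMap.congr_fun hφ (Basis.span S.root_indep i)
    rw [Basis.constr_basis] at h
    simpa [Basis.span_apply] using h
  exact ⟨φ, fun i hi => by simp [this, hi], fun i hi => by simp [this, hi]⟩

lemma dual_WI {L : Set (Fin m)} {φ : V →ₗ[ℝ] ℝ} (h : ∀ i ∈ L, φ (S.root i) = 0) (μ : V)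
    {u : V ≃ₗ[ℝ] V} (hu : u ∈ S.WI L) : φ (u μ) = φ μ := by
  refine S.WI_induction (p := fun u => φ (u μ) = φ μ) rfl ?_ hu
  intro i hi u _ hu
  rw [LinearEquiv.mul_apply, s_apply, map_sub, map_smul, h i hi, hu]; simp

lemma orbit_WI {μ : V} (hμ : μ ∈ S.chamber) {L : Set (Fin m)} {u : V ≃ₗ[ℝ] V} (hu : u ∈ S.WI L) :
    ∃ c : Fin m → ℝ, (∀ k, 0 ≤ c k) ∧ (∀ k ∉ L, c k = 0) ∧ u μ = μ - ∑ k, c k • S.root k := by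
  obtain ⟨c, hc, hcu, -⟩ := S.orbit hμ (S.WI_le L hu)
  refine ⟨c, hc, fun k hk => ?_, hcu⟩
  obtain ⟨φ, h0, h1⟩ := S.exists_dual {k}ᶜ
  have := S.dual_WI (L := L) (φ := φ) (fun i hi => h0 i (by rintro rfl; exact hk hi)) μ hu
  rw [hcu, map_sub, map_sum, Finset.sum_eq_single k] at this
  · rw [map_smul, h1 k (by simp)] at this
    simpa using this
  · intro j _ hj
    rw [map_smul, h0 j (by simpa using hj)]; simp
  · simp

/-- `F_L` is a face of `H`. -/
theorem face_isFace {μ : V} (hμ : μ ∈ S.chamber) (L : Set (Fin m)) :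
    IsFaceOf (S.orbitHull μ) (S.face μ L) := by
  refine ⟨convex_convexHull ℝ _, ?_⟩
  obtain ⟨φ, h0, h1⟩ := S.exists_dual L
  have hsub : S.face μ L ⊆ S.orbitHull μ :=
    convexHull_mono (Set.image_mono (S.WI_le L))
  have hF : ∀ x ∈ S.face μ L, φ x = φ μ := by
    intro x hx
    have : S.face μ L ⊆ {x | φ x = φ μ} := by
      apply convexHull_min
      · rintro _ ⟨u, hu, rfl⟩
        exact S.dual_WI h0 μ hu
      · exact convex_hyperplane φ.isLinear _
    exact this hx
  have hH : S.orbitHull μ ⊆ {x | φ x ≤ φ μ ∧ (φ x = φ μ → x ∈ S.face μ L)} := by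
    apply convexHull_min
    · rintro _ ⟨u, hu, rfl⟩
      obtain ⟨c, hc, hcu, v, hv, hvu⟩ := S.orbit hμ hu
      have hφ : φ (u μ) = φ μ - ∑ k, c k * φ (S.root k) := by
        rw [hcu]; simp
      have hnn : ∀ k, 0 ≤ c k * φ (S.root k) := by
        intro k
        by_cases hk : k ∈ L
        · rw [h0 k hk]; simp
        · rw [h1 k hk]; simpa using hc k
      refine ⟨?_, fun heq => ?_⟩
      · show φ (u μ) ≤ φ μ
        rw [hφ]; linarith [Finset.sum_nonneg fun k (_ : k ∈ Finset.univ) => hnn k]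
      · change φ (u μ) = φ μ at heq
        have hs : ∑ k, c k * φ (S.root k) = 0 := by linarith
        rw [Finset.sum_eq_zero_iff_of_nonneg fun k _ => hnn k] at hs
        show u μ ∈ S.face μ L
        rw [hvu]
        refine subset_convexHull ℝ _ ⟨v, S.WI_mono ?_ hv, rfl⟩
        intro k hk
        by_contra hkL
        have := hs k (Finset.mem_univ k)
        rw [h1 k hkL, mul_one] at this
        exact hk this
    · rintro x ⟨hx, hx'⟩ y ⟨hy, hy'⟩ a b ha hb hab
      have e : φ (a • x + b • y) = a * φ x + b * φ y := by simp
      refine ⟨?_, fun heq => ?_⟩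
      · rw [e]
        have : φ μ = a * φ μ + b * φ μ := by rw [← add_mul, hab, one_mul]
        rw [this]; gcongr
      · rw [e] at heq
        have : φ μ = a * φ μ + b * φ μ := by rw [← add_mul, hab, one_mul]
        rcases ha.eq_or_lt with rfl | ha'
        · obtain rfl : b = 1 := by linarith
          simp at heq ⊢
          exact hy' heq
        rcases hb.eq_or_lt with rfl | hb'
        · obtain rfl : a = 1 := by linarith
          simp at heq ⊢
          exact hx' heq
        refine convex_convexHull ℝ _ (hx' ?_) (hy' ?_) ha hb hab <;> nlinarith
  refine ⟨hsub, ?_⟩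
  rintro x hx y hy z hz ⟨a, b, ha, hb, hab, rfl⟩
  have hz' := hF _ hz
  have e : φ (a • x + b • y) = a * φ x + b * φ y := by simp
  have hx1 := (hH hx).1
  have hy1 := (hH hy).1
  have : φ μ = a * φ μ + b * φ μ := by rw [← add_mul, hab, one_mul]
  rw [e] at hz'
  exact (hH hx).2 (by nlinarith)

/-! ### `μ`-connectedness -/

lemma muConnected_iff (μ : V) (I : Set (Fin m)) : S.MuConnected μ I ↔
    ∀ B : Set (Fin m), (∀ j ∈ I, S.coroot j μ ≠ 0 → j ∈ B) →
      (∀ j ∈ I, j ∈ B → ∀ k ∈ I, S.coroot k (S.root j) ≠ 0 → k ∈ B) → I ⊆ B := by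
  constructor
  · intro h B h1 h2 i hi
    obtain ⟨j, hj, hr⟩ := h ⟨i, hi⟩
    have key : ∀ a b : I, (S.diagram.induce I).Reachable a b → (b : Fin m) ∈ B → (a : Fin m) ∈ B := by
      rintro a b ⟨p⟩
      induction p with
      | nil => exact id
      | @cons u v w huv p ih =>
        intro hw
        refine h2 v v.2 (ih hw) u u.2 ?_
        have : S.Adjacent u v := huv
        rw [S.pairing]
        exact_mod_cast this.2.1
    exact key _ _ hr (h1 j j.2 hj)
  · intro h
    have := h {i | ∃ hi : i ∈ I, ∃ j : I, S.coroot (j : Fin m) μ ≠ 0 ∧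
      (S.diagram.induce I).Reachable ⟨i, hi⟩ j} ?_ ?_
    · intro i
      obtain ⟨_, h⟩ := this i.2
      exact h
    · intro j hj hjμ
      exact ⟨hj, ⟨j, hj⟩, hjμ, SimpleGraph.Reachable.refl _⟩
    · rintro j hj ⟨_, t, ht, hr⟩ k hk hkj
      refine ⟨hk, t, ht, ?_⟩
      by_cases hjk : k = j
      · subst hjk; exact hr
      refine SimpleGraph.Reachable.trans (SimpleGraph.Adj.reachable ?_) hr
      show S.Adjacent k j
      rw [S.pairing] at hkj
      have h1 : S.A k j ≠ 0 := by exact_mod_cast hkj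
      exact ⟨hjk, h1, fun h0 => h1 ((S.A_zero_iff j k).1 h0)⟩

lemma coroot_root_zero {i j : Fin m} (h : S.coroot i (S.root j) = 0) :
    S.coroot j (S.root i) = 0 := by
  rw [S.pairing] at *
  have h1 : S.A i j = 0 := by exact_mod_cast h
  exact_mod_cast (S.A_zero_iff i j).1 h1

lemma muConnected_union {μ : V} {I J : Set (Fin m)} (hI : S.MuConnected μ I)
    (hJ : S.MuConnected μ J) : S.MuConnected μ (I ∪ J) := by
  rw [muConnected_iff] at *
  intro B h1 h2
  exact Set.union_subset
    (hI B (fun j hj => h1 j (Or.inl hj)) fun j hj hB k hk => h2 j (Or.inl hj) hB k (Or.inl hk))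
    (hJ B (fun j hj => h1 j (Or.inr hj)) fun j hj hB k hk => h2 j (Or.inr hj) hB k (Or.inr hk))

lemma muConnected_insert {μ : V} {I : Set (Fin m)} (hI : S.MuConnected μ I) {i : Fin m}
    (hi : i ∉ S.starSet μ I) : S.MuConnected μ (insert i I) := by
  rw [muConnected_iff] at *
  intro B h1 h2
  have hIB := hI B (fun j hj => h1 j (Or.inr hj))
    fun j hj hB k hk => h2 j (Or.inr hj) hB k (Or.inr hk)
  refine Set.insert_subset ?_ hIB
  by_cases hiI : i ∈ I
  · exact hIB hiI
  by_contra hiB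
  apply hi
  refine ⟨?_, hiI, fun j hj => ?_⟩
  · by_contra h
    exact hiB (h1 i (Or.inl rfl) h)
  · by_contra h
    exact hiB (h2 j (Or.inr hj) (hIB hj) i (Or.inl rfl) h)

/-- Moving by `s_j` a point where `α_j∨` does not vanish. -/
lemma exists_ne_of_adj {μ : V} {K : Set (Fin m)} {j k : Fin m} (hj : j ∈ K)
    (h : ∃ u ∈ S.WI K, S.coroot j (u μ) ≠ 0) (hkj : S.coroot k (S.root j) ≠ 0) :
    ∃ u ∈ S.WI K, S.coroot k (u μ) ≠ 0 := by
  obtain ⟨u, hu, hne⟩ := h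
  by_contra hcon
  push Not at hcon
  have h1 := hcon u hu
  have h2 := hcon (S.s j * u) (Subgroup.mul_mem _ (S.s_mem_WI hj) hu)
  rw [LinearEquiv.mul_apply, coroot_s, h1] at h2
  have : S.coroot k (S.root j) * S.coroot j (u μ) = 0 := by linarith
  exact (mul_ne_zero hkj hne) this

lemma starSet_of_nonpos {μ : V} (hμ : μ ∈ S.chamber) {K : Set (Fin m)} (hK : S.MuConnected μ K)
    {c : Fin m → ℝ} (hc : ∀ k, 0 ≤ c k) (h0 : ∑ k, c k * S.coroot k μ = 0)
    (hle : ∀ u ∈ S.WI K, ∑ k, c k * S.coroot k (u μ) ≤ 0) (k : Fin m) (hk : c k ≠ 0) :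
    k ∈ S.starSet μ K := by
  set T : Set (Fin m) := {k | c k ≠ 0} with hT
  have hTJ : ∀ k ∈ T, S.coroot k μ = 0 := by
    intro k hk
    rw [Finset.sum_eq_zero_iff_of_nonneg fun k _ => mul_nonneg (hc k) (hμ k)] at h0
    exact (mul_eq_zero.1 (h0 k (Finset.mem_univ k))).resolve_left hk
  have hvan : ∀ k ∈ T, ∀ u ∈ S.WI (K \ T), S.coroot k (u μ) = 0 := by
    intro k hk u hu
    obtain ⟨d, hd, hdL, hdu⟩ := S.orbit_WI hμ hu
    have hnn : ∀ k, 0 ≤ c k * S.coroot k (u μ) := by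
      intro k
      by_cases hk : c k = 0
      · simp [hk]
      refine mul_nonneg (hc k) ?_
      rw [hdu, map_sub, hTJ k hk, map_sum, zero_sub, neg_nonneg]
      apply Finset.sum_nonpos
      intro j _
      rw [map_smul, smul_eq_mul]
      by_cases hj : j = k
      · rw [hdL j (by rintro ⟨-, h⟩; exact h (hj ▸ hk))]; simp
      · exact mul_nonpos_of_nonneg_of_nonpos (hd j) (S.coroot_offdiag (Ne.symm hj))
    have hz : ∑ k, c k * S.coroot k (u μ) = 0 :=
      le_antisymm (hle u (S.WI_mono Set.diff_subset hu)) (Finset.sum_nonneg fun k _ => hnn k)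
    rw [Finset.sum_eq_zero_iff_of_nonneg fun k _ => hnn k] at hz
    exact (mul_eq_zero.1 (hz k (Finset.mem_univ k))).resolve_left hk
  have hB : K ⊆ {j | j ∉ T ∧ ∃ u ∈ S.WI (K \ T), S.coroot j (u μ) ≠ 0} := by
    refine (S.muConnected_iff μ K).1 hK _ ?_ ?_
    · intro j hj hjμ
      exact ⟨fun h => hjμ (hTJ j h), 1, Subgroup.one_mem _, hjμ⟩
    · rintro j hj ⟨hjT, hju⟩ k hk hkj
      have := S.exists_ne_of_adj (K := K \ T) ⟨hj, hjT⟩ hju hkj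
      refine ⟨fun h => ?_, this⟩
      obtain ⟨u, hu, hne⟩ := this
      exact hne (hvan k h u hu)
  refine ⟨hTJ k hk, fun h => (hB h).1 hk, fun j hj => ?_⟩
  by_contra hkj
  obtain ⟨hjT, hju⟩ := hB hj
  obtain ⟨u, hu, hne⟩ := S.exists_ne_of_adj (K := K \ T) ⟨hj, hjT⟩ hju hkj
  exact hne (hvan k hk u hu)

/-! ### Faces and reflections -/

lemma orbitHull_s {μ : V} {x : V} (hx : x ∈ S.orbitHull μ) (i : Fin m) :
    S.s i x ∈ S.orbitHull μ := by
  have : S.orbitHull μ ⊆ (S.s i : V →ₗ[ℝ] V) ⁻¹' S.orbitHull μ := by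
    apply convexHull_min
    · rintro _ ⟨u, hu, rfl⟩
      exact subset_convexHull ℝ _ ⟨S.s i * u, S.W.mul_mem (S.s_mem i) hu, rfl⟩
    · exact (convex_convexHull ℝ _).linear_preimage _
  exact this hx

lemma face_s_mem_of_signs {μ : V} {F : Set V} (hF : IsFaceOf (S.orbitHull μ) F) {i : Fin m}
    {x y : V} (hx : x ∈ F) (hy : y ∈ F) (hxi : 0 < S.coroot i x) (hyi : S.coroot i y < 0) :
    S.s i x ∈ F ∧ S.s i y ∈ F := by
  obtain ⟨hconv, hext⟩ := hF
  set p := S.coroot i x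
  set q := S.coroot i y
  have hpq : 0 < p - q := by linarith
  have ha : 0 < -q / (p - q) := div_pos (by linarith) hpq
  have hb : 0 < p / (p - q) := div_pos hxi hpq
  have hab : -q / (p - q) + p / (p - q) = 1 := by field_simp; ring
  have hz : (-q / (p - q)) • x + (p / (p - q)) • y ∈ F := hconv hx hy ha.le hb.le hab
  have hfix : (-q / (p - q)) • x + (p / (p - q)) • y =
      (-q / (p - q)) • S.s i x + (p / (p - q)) • S.s i y := by
    have e : (-q / (p - q)) * p + (p / (p - q)) * q = 0 := by field_simp; ring
    rw [s_apply, s_apply]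
    change _ = (-q / (p - q)) • (x - p • S.root i) + (p / (p - q)) • (y - q • S.root i)
    have e2 : (-q / (p - q)) • (x - p • S.root i) + (p / (p - q)) • (y - q • S.root i) =
      (-q / (p - q)) • x + (p / (p - q)) • y -
        ((-q / (p - q)) * p + (p / (p - q)) * q) • S.root i := by module
    rw [e2, e]; simp
  have hxH := S.orbitHull_s (hext.1 hx) i
  have hyH := S.orbitHull_s (hext.1 hy) i
  exact ⟨hext.2 hxH hyH hz ⟨_, _, ha, hb, hab, hfix.symm⟩,
    hext.2 hyH hxH hz ⟨_, _, hb, ha, by rw [add_comm]; exact hab, by rw [add_comm]; exact hfix.symm⟩⟩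

lemma face_s_invariant {μ : V} {F : Set V} (hF : IsFaceOf (S.orbitHull μ) F) {i : Fin m}
    (hp : ∃ x ∈ F, 0 < S.coroot i x) (hn : ∃ y ∈ F, S.coroot i y < 0) {z : V} (hz : z ∈ F) :
    S.s i z ∈ F := by
  obtain ⟨x, hx, hxi⟩ := hp
  obtain ⟨y, hy, hyi⟩ := hn
  rcases lt_trichotomy (S.coroot i z) 0 with h | h | h
  · exact (S.face_s_mem_of_signs hF hx hz hxi h).2
  · rw [s_apply, h]; simpa using hz
  · exact (S.face_s_mem_of_signs hF hz hy h hyi).1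

lemma face_invariant_of_face_subset {μ : V} {F : Set V} (hF : IsFaceOf (S.orbitHull μ) F)
    {K : Set (Fin m)} (hK : S.MuConnected μ K) (hsub : S.face μ K ⊆ F) {i : Fin m} (hi : i ∈ K)
    {z : V} (hz : z ∈ F) : S.s i z ∈ F := by
  have hB : K ⊆ {j | ∃ u ∈ S.WI K, S.coroot j (u μ) ≠ 0} := by
    refine (S.muConnected_iff μ K).1 hK _ ?_ ?_
    · intro j hj hjμ
      exact ⟨1, Subgroup.one_mem _, hjμ⟩
    · intro j hj hju k hk hkj
      exact S.exists_ne_of_adj hj hju hkj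
  obtain ⟨u, hu, hne⟩ := hB hi
  have h1 : u μ ∈ F := hsub (subset_convexHull ℝ _ ⟨u, hu, rfl⟩)
  have h2 : S.s i (u μ) ∈ F :=
    hsub (subset_convexHull ℝ _ ⟨S.s i * u, Subgroup.mul_mem _ (S.s_mem_WI hi) hu, rfl⟩)
  have h3 := S.coroot_s_self i (u μ)
  rcases lt_or_gt_of_ne hne with h | h
  · exact S.face_s_invariant hF ⟨_, h2, by linarith⟩ ⟨_, h1, h⟩ hz
  · exact S.face_s_invariant hF ⟨_, h1, h⟩ ⟨_, h2, by linarith⟩ hz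

lemma face_subset_of_invariant {μ : V} {F : Set V} (hF : Convex ℝ F) (hμF : μ ∈ F)
    {K : Set (Fin m)} (h : ∀ i ∈ K, ∀ z ∈ F, S.s i z ∈ F) : S.face μ K ⊆ F := by
  apply convexHull_min _ hF
  rintro _ ⟨u, hu, rfl⟩
  refine S.WI_induction (p := fun u => u μ ∈ F) hμF ?_ hu
  intro i hi u _ hu
  exact h i hi _ hu

lemma mem_face (μ : V) (K : Set (Fin m)) : μ ∈ S.face μ K :=
  subset_convexHull ℝ _ ⟨1, Subgroup.one_mem _, rfl⟩

lemma starSet_insert_subset (μ : V) (I : Set (Fin m)) (i : Fin m) :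
    S.starSet μ (insert i I) ⊆ S.starSet μ I := by
  rintro k ⟨h1, h2, h3⟩
  exact ⟨h1, fun h => h2 (Or.inr h), fun j hj => h3 j (Or.inr hj)⟩

lemma s_comm {i k : Fin m} (h : S.coroot k (S.root i) = 0) : S.s i * S.s k = S.s k * S.s i := by
  have h' := S.coroot_root_zero h
  ext x
  simp only [LinearEquiv.mul_apply, s_apply, map_sub, map_smul, h, h']
  module

lemma comm_starSet_insert (μ : V) (I : Set (Fin m)) (i : Fin m) {a : V ≃ₗ[ℝ] V}
    (ha : a ∈ S.WI (S.starSet μ (insert i I))) : S.s i * a = a * S.s i := by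
  refine S.WI_induction (p := fun a => S.s i * a = a * S.s i) (by simp) ?_ ha
  rintro k ⟨-, -, hk⟩ u - hu
  rw [← mul_assoc, S.s_comm (hk i (Or.inl rfl)), mul_assoc, hu, mul_assoc]

lemma exists_regular : ∃ ρ : V, ∀ k, 0 < S.coroot k ρ := by
  classical
  have := S.finDim
  obtain ⟨φ, hφ⟩ := ((Basis.span S.coroot_indep).constr ℝ (fun _ => (1:ℝ))).exists_extend
  refine ⟨(Module.evalEquiv ℝ V).symm φ, fun k => ?_⟩
  have h := LinearMap.congr_fun hφ (Basis.span S.coroot_indep k)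
  rw [Basis.constr_basis] at h
  have h' : φ (S.coroot k) = 1 := by simpa [Basis.span_apply] using h
  rw [Module.apply_evalEquiv_symm_apply, h']
  exact one_pos

/-- The main induction. -/
theorem main_induction {μ : V} (hμ : μ ∈ S.chamber) {I' : Set (Fin m)}
    (hI' : S.MuConnected μ I') (l : List (Fin m)) : ∀ I : Set (Fin m), S.MuConnected μ I →
    l.length = S.len (l.map S.s).prod →
    (∀ a ∈ S.WI (S.starSet μ I), ∀ b ∈ S.WI (S.starSet μ I'),
      S.len (l.map S.s).prod ≤ S.len (a * (l.map S.s).prod * b)) →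
    S.MuConnected μ (I ∪ I' ∪ ↑l.toFinset) ∧
    ∀ F, IsFaceOf (S.orbitHull μ) F → S.face μ I ⊆ F →
      (∀ x ∈ S.face μ I', (l.map S.s).prod x ∈ F) → S.face μ (I ∪ I' ∪ ↑l.toFinset) ⊆ F := by
  induction l with
  | nil =>
    intro I hI _ _
    simp only [List.toFinset_nil, Finset.coe_empty, Set.union_empty]
    refine ⟨S.muConnected_union hI hI', fun F hF h1 h2 => ?_⟩
    refine S.face_subset_of_invariant hF.1 (h1 (S.mem_face μ I)) ?_
    rintro i (hi | hi) z hz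
    · exact S.face_invariant_of_face_subset hF hI h1 hi hz
    · exact S.face_invariant_of_face_subset hF hI' (fun x hx => h2 x hx) hi hz
  | cons i l ih =>
    intro I hI hlen hmin
    have hset : I ∪ I' ∪ ((i :: l).toFinset : Set (Fin m)) =
        insert i I ∪ I' ∪ (l.toFinset : Set (Fin m)) := by
      ext k; simp; tauto
    rw [hset]
    simp only [List.map_cons, List.prod_cons, List.length_cons] at hlen hmin ⊢
    set w' := (l.map S.s).prod with hw'
    have hw'W : w' ∈ S.W := S.prod_mem l
    have hlen1 := S.len_prod_le l
    have hlen2 := S.len_s_mul_le i hw'W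
    rw [← hw'] at hlen1
    have hlw : l.length = S.len w' := by omega
    have hlt : S.len w' < S.len (S.s i * w') := by omega
    have histar : i ∉ S.starSet μ I := by
      intro h
      have := hmin (S.s i) (S.s_mem_WI h) 1 (Subgroup.one_mem _)
      rw [s_mul_s_mul, mul_one] at this
      omega
    have hI1 := S.muConnected_insert hI histar
    have hmin' : ∀ a ∈ S.WI (S.starSet μ (insert i I)), ∀ b ∈ S.WI (S.starSet μ I'),
        S.len w' ≤ S.len (a * w' * b) := by
      intro a ha b hb
      have h1 := hmin a (S.WI_mono (S.starSet_insert_subset μ I i) ha) b hb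
      have h2 : a * (S.s i * w') * b = S.s i * (a * w' * b) := by
        rw [← mul_assoc a, ← S.comm_starSet_insert μ I i ha]
        simp only [mul_assoc]
      rw [h2] at h1
      have h3 := S.len_s_mul_le i (S.W.mul_mem (S.W.mul_mem (S.WI_le _ ha) hw'W) (S.WI_le _ hb))
      omega
    obtain ⟨c1, c2⟩ := ih (insert i I) hI1 hlw hmin'
    refine ⟨c1, fun F hF h1 h2 => ?_⟩
    have hμF : μ ∈ F := h1 (S.mem_face μ I)
    have hpos : S.PosFun (fun x => S.coroot i (w' x)) := S.posFun_of_len hw'W hlt.le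
    -- a positive value on `F`
    have hp : ∃ x ∈ F, 0 < S.coroot i x := by
      classical
      by_contra hcon
      push Not at hcon
      apply histar
      refine S.starSet_of_nonpos hμ hI (c := fun k => if k = i then 1 else 0)
        (fun k => by positivity) ?_ ?_ i (by simp)
      · simp only [ite_mul, one_mul, zero_mul, Finset.sum_ite_eq', Finset.mem_univ, if_true]
        exact le_antisymm (hcon μ hμF) (hμ i)
      · intro u hu
        simp only [ite_mul, one_mul, zero_mul, Finset.sum_ite_eq', Finset.mem_univ, if_true]
        exact hcon _ (h1 (subset_convexHull ℝ _ ⟨u, hu, rfl⟩))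
    -- a negative value on `F`
    have hn : ∃ y ∈ F, S.coroot i y < 0 := by
      by_contra hcon
      push Not at hcon
      obtain ⟨c, hc, hcx⟩ := hpos
      have hle : ∀ u ∈ S.WI I', ∑ k, c k * S.coroot k (u μ) ≤ 0 := by
        intro u hu
        rw [← hcx]
        have := hcon _ (h2 _ (subset_convexHull ℝ _ ⟨u, hu, rfl⟩))
        rw [LinearEquiv.mul_apply, coroot_s_self] at this
        simpa using this
      have h0 : ∑ k, c k * S.coroot k μ = 0 :=
        le_antisymm (hle 1 (Subgroup.one_mem _))
          (Finset.sum_nonneg fun k _ => mul_nonneg (hc k) (hμ k))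
      have hsupp := S.starSet_of_nonpos hμ hI' hc h0 hle
      set w := S.s i * w' with hw
      have hwW : w ∈ S.W := S.W.mul_mem (S.s_mem i) hw'W
      have hposk : ∀ k, c k ≠ 0 → S.PosFun (fun x => S.coroot k (w⁻¹ x)) := by
        intro k hk
        apply S.posFun_of_len (S.W.inv_mem hwW)
        have h3 := hmin 1 (Subgroup.one_mem _) (S.s k) (S.s_mem_WI (hsupp k hk))
        rw [one_mul, ← S.len_inv hwW,
          ← S.len_inv (S.W.mul_mem hwW (S.s_mem k)), mul_inv_rev, s_inv] at h3
        exact h3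
      -- pick a strictly dominant point
      obtain ⟨ρ, hρ⟩ := S.exists_regular
      have hρc : ρ ∈ S.chamber := fun k => (hρ k).le
      have h4 := hcx (w⁻¹ ρ)
      have h5 : S.coroot i (w' (w⁻¹ ρ)) = - S.coroot i ρ := by
        have : w' (w⁻¹ ρ) = S.s i ρ := by
          rw [← LinearEquiv.mul_apply, hw, mul_inv_rev, s_inv, mul_inv_cancel_left]
        rw [this, coroot_s_self]
      have h6 : 0 ≤ ∑ k, c k * S.coroot k (w⁻¹ ρ) := by
        apply Finset.sum_nonneg
        intro k _
        by_cases hk : c k = 0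
        · simp [hk]
        · exact mul_nonneg (hc k) ((hposk k hk).nonneg S hρc)
      beta_reduce at h4
      rw [h5] at h4
      linarith [hρ i]
    have hinv : ∀ z ∈ F, S.s i z ∈ F := fun z hz => S.face_s_invariant hF hp hn hz
    refine c2 F hF ?_ ?_
    · refine S.face_subset_of_invariant hF.1 hμF ?_
      rintro k (rfl | hk) z hz
      · exact hinv z hz
      · exact S.face_invariant_of_face_subset hF hI h1 hk hz
    · intro x hx
      have := hinv _ (h2 x hx)
      rwa [LinearEquiv.mul_apply, s_s] at this

end GCMRealization

open GCMRealization in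
theorem statement_18 {m : ℕ} {V : Type*} [NormedAddCommGroup V] [NormedSpace ℝ V]
    (S : GCMRealization m V) (μ : V) (hμ : μ ∈ S.chamber)
    (I I' : Set (Fin m)) (hI : S.MuConnected μ I) (hI' : S.MuConnected μ I')
    (w : V ≃ₗ[ℝ] V) (hw : w ∈ S.W)
    (hmin : ∀ a ∈ S.WI (S.starSet μ I), ∀ b ∈ S.WI (S.starSet μ I'),
      S.len w ≤ S.len (a * w * b))
    (l : List (Fin m)) (hl : w = (l.map S.s).prod) (hlen : l.length = S.len w) :
    S.MuConnected μ (I ∪ I' ∪ ↑l.toFinset) ∧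
    IsLeast {F : Set V | IsFaceOf (S.orbitHull μ) F ∧
      S.face μ I ∪ (fun x => w x) '' S.face μ I' ⊆ F} (S.face μ (I ∪ I' ∪ ↑l.toFinset)) := by
  subst hl
  obtain ⟨h1, h2⟩ := S.main_induction hμ hI' l I hI hlen hmin
  refine ⟨h1, ⟨S.face_isFace hμ _, ?_⟩, ?_⟩
  · have hin : ∀ i ∈ (I ∪ I' ∪ (↑l.toFinset : Set (Fin m))), ∀ z ∈ S.face μ (I ∪ I' ∪ ↑l.toFinset),
        S.s i z ∈ S.face μ (I ∪ I' ∪ ↑l.toFinset) := fun i hi z hz =>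
      S.face_invariant_of_face_subset (S.face_isFace hμ _) h1 subset_rfl hi hz
    have hsub : ∀ K ⊆ (I ∪ I' ∪ (↑l.toFinset : Set (Fin m))),
        S.face μ K ⊆ S.face μ (I ∪ I' ∪ ↑l.toFinset) := fun K hK =>
      convexHull_mono (Set.image_mono (S.WI_mono hK))
    apply Set.union_subset
    · exact hsub I (fun i hi => Or.inl (Or.inl hi))
    · rintro _ ⟨x, hx, rfl⟩
      have hx' := hsub I' (fun i hi => Or.inl (Or.inr hi)) hx
      have key : ∀ l' : List (Fin m), (∀ i ∈ l', i ∈ l) →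
          (l'.map S.s).prod x ∈ S.face μ (I ∪ I' ∪ ↑l.toFinset) := by
        intro l' hl'
        induction l' with
        | nil => simpa using hx'
        | cons i l' ih =>
          rw [List.map_cons, List.prod_cons, LinearEquiv.mul_apply]
          refine hin i (Or.inr ?_) _ (ih fun j hj => hl' j (List.mem_cons_of_mem _ hj))
          simpa using hl' i (List.mem_cons_self)
      exact key l fun i hi => hi
  · rintro F ⟨hF, hFsub⟩
    exact h2 F hF (fun x hx => hFsub (Or.inl hx)) (fun x hx => hFsub (Or.inr ⟨x, hx, rfl⟩))
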